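/- Let 𝒪 ⊂ ℝ^{m−k} × ℝ^n be open and let φ : 𝒪 → ℝᵏ be uniformly intrinsically differentiable at every point of 𝒪. Then φ is intrinsic Lipschitz on every compact subset of 𝒪: for every compact K ⊂ 𝒪 there is a constant C_L ≥ 0 such that |φ(B) − φ(A)|_{ℝᵏ} ≤ C_L·σ_φ(A,B) for all A, B ∈ K. -/

import Mathlib

noncomputable section

open Set Filter Topology MeasureTheory

namespace Carnot

/-- Euclidean norm on `Fin d → ℝ`. -/
def enorm {d : ℕ} (x : Fin d → ℝ) : ℝ := Real.sqrt (∑ i, (x i) ^ 2)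

/-- The underlying set of the Carnot group `G = ℝ^m × ℝ^n` of class `𝓑`. -/
abbrev G (m n : ℕ) := (Fin m → ℝ) × (Fin n → ℝ)

/-- Points of the normal complement `W`, identified with `ℝ^(m-k) × ℝ^n`. -/
abbrev W (m n k : ℕ) := (Fin (m - k) → ℝ) × (Fin n → ℝ)

/-- The group law of the Carnot group of class `𝓑` associated with the
skew-symmetric matrices `b s`:
`(x,y)·(x',y') = (x + x', y + y' + ½⟨Bx,x'⟩)`. -/
def gmul {m n : ℕ} (b : Fin n → Matrix (Fin m) (Fin m) ℝ) (P Q : G m n) : G m n :=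
  (P.1 + Q.1, fun s => P.2 s + Q.2 s + (1 / 2) * ∑ i, ∑ j, b s i j * P.1 j * Q.1 i)

/-- The group inverse `(x,y)⁻¹ = (-x,-y)`. -/
def ginv {m n : ℕ} (P : G m n) : G m n := (-P.1, -P.2)

/-- The homogeneous quasi-norm `N(x,y) = |x| + |y|^(1/2)`. -/
def qnorm {m n : ℕ} (P : G m n) : ℝ := enorm P.1 + Real.sqrt (enorm P.2)

/-- Open ball for the quasi-norm: `U(P,r) = {Q : N(P⁻¹·Q) < r}`. -/
def ball (m n : ℕ) (b : Fin n → Matrix (Fin m) (Fin m) ℝ) (P : G m n) (r : ℝ) : Set (G m n) :=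
  {Q | qnorm (gmul b (ginv P) Q) < r}

/-- The embedding `i : ℝ^(m-k) × ℝ^n → G`, `i(a,α) = (0,…,0,a,α)`. -/
def embW (m n k : ℕ) (A : W m n k) : G m n :=
  (fun j => if h : (j : ℕ) < k then 0 else A.1 ⟨(j : ℕ) - k, by have := j.isLt; omega⟩, A.2)

/-- The embedding of `ℝ^k` as the horizontal subgroup `H`, `v ↦ (v,0,…,0)`. -/
def embH (m n k : ℕ) (v : Fin k → ℝ) : G m n :=
  (fun j => if h : (j : ℕ) < k then v ⟨(j : ℕ), h⟩ else 0, 0)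

/-- The graph map `Φ(A) = i(A)·φ̂(A)`. -/
def graphMap (m n k : ℕ) (b : Fin n → Matrix (Fin m) (Fin m) ℝ)
    (φ : W m n k → Fin k → ℝ) (A : W m n k) : G m n :=
  gmul b (embW m n k A) (embH m n k (φ A))

/-- `N(i(A)⁻¹·i(B))`. -/
def dW (m n k : ℕ) (b : Fin n → Matrix (Fin m) (Fin m) ℝ) (A B : W m n k) : ℝ :=
  qnorm (gmul b (ginv (embW m n k A)) (embW m n k B))

/-- The graph quasi-distance `σ_φ(A,B) = N(φ̂(A)⁻¹·i(A)⁻¹·i(B)·φ̂(A))`. -/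
def sigma (m n k : ℕ) (b : Fin n → Matrix (Fin m) (Fin m) ℝ)
    (φ : W m n k → Fin k → ℝ) (A B : W m n k) : ℝ :=
  qnorm (gmul b (gmul b (gmul b (ginv (embH m n k (φ A))) (ginv (embW m n k A)))
    (embW m n k B)) (embH m n k (φ A)))

/-- The matrix `M` satisfies the uniform intrinsic differentiability condition of `φ`
at `A₀ ∈ 𝒪`. -/
def UID (m n k : ℕ) (b : Fin n → Matrix (Fin m) (Fin m) ℝ) (O : Set (W m n k))
    (φ : W m n k → Fin k → ℝ) (A₀ : W m n k) (M : Matrix (Fin k) (Fin (m - k)) ℝ) : Prop :=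
  ∀ ε > 0, ∃ r > 0, ∀ A ∈ O, ∀ B ∈ O,
    dW m n k b A₀ A < r → dW m n k b A B < r → 0 < dW m n k b A B →
    enorm (fun j => φ B j - φ A j - ∑ i, M j i * (B.1 i - A.1 i)) ≤ ε * sigma m n k b φ A B

/-- `f : U → ℝ^k` is of class `C¹_G` with (continuous) horizontal Jacobian `gradf`. -/
def C1G (m n k : ℕ) (b : Fin n → Matrix (Fin m) (Fin m) ℝ) (U : Set (G m n))
    (f : G m n → Fin k → ℝ) (gradf : G m n → Matrix (Fin k) (Fin m) ℝ) : Prop :=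
  ContinuousOn f U ∧ ContinuousOn gradf U ∧
  ∀ P ∈ U, ∀ ε > 0, ∃ r > 0, ∀ Q ∈ U,
    qnorm (gmul b (ginv P) Q) < r →
    enorm (fun j => f Q j - f P j - ∑ i, gradf P j i * (Q.1 i - P.1 i)) ≤
      ε * qnorm (gmul b (ginv P) Q)

/-- The square block `M₁(Q) = (X_i f_j(Q))_{j,i=1,…,k}` of the horizontal Jacobian. -/
def M1 (m n k : ℕ) (hk : k ≤ m) (gradf : G m n → Matrix (Fin k) (Fin m) ℝ) (Q : G m n) :
    Matrix (Fin k) (Fin k) ℝ :=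
  Matrix.of fun j i => gradf Q j (Fin.castLE hk i)

/-- The block `M₂(Q) = (X_{k+i} f_j(Q))_{j=1,…,k; i=1,…,m-k}` of the horizontal Jacobian. -/
def M2 (m n k : ℕ) (gradf : G m n → Matrix (Fin k) (Fin m) ℝ) (Q : G m n) :
    Matrix (Fin k) (Fin (m - k)) ℝ :=
  Matrix.of fun j i => gradf Q j ⟨k + (i : ℕ), by have := i.isLt; omega⟩

lemma enorm_eq_norm {d : ℕ} (x : Fin d → ℝ) : enorm x = ‖WithLp.toLp 2 x‖ := by
  simp [enorm, EuclideanSpace.norm_eq]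

lemma enorm_nonneg {d : ℕ} (x : Fin d → ℝ) : 0 ≤ enorm x := Real.sqrt_nonneg _

lemma enorm_add_le {d : ℕ} (x y : Fin d → ℝ) : enorm (x + y) ≤ enorm x + enorm y := by
  simpa only [enorm_eq_norm, WithLp.toLp_add] using norm_add_le _ _

@[simp] lemma enorm_zero {d : ℕ} : enorm (0 : Fin d → ℝ) = 0 := by simp [enorm_eq_norm]

lemma enorm_eq_zero {d : ℕ} {x : Fin d → ℝ} : enorm x = 0 ↔ x = 0 := by
  simp [enorm_eq_norm]

lemma abs_apply_le_enorm {d : ℕ} (x : Fin d → ℝ) (i : Fin d) : |x i| ≤ enorm x := by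
  rw [enorm_eq_norm]
  exact PiLp.norm_apply_le (WithLp.toLp 2 x) i

lemma continuous_enorm {d : ℕ} : Continuous (enorm : (Fin d → ℝ) → ℝ) := by
  unfold enorm
  fun_prop

lemma exists_enorm_mulVec_le {p q : ℕ} (M : Matrix (Fin p) (Fin q) ℝ) :
    ∃ C : ℝ, 0 ≤ C ∧ ∀ v, enorm (M.mulVec v) ≤ C * enorm v := by
  let L := LinearMap.toContinuousLinearMap (Matrix.toEuclideanLin M)
  refine ⟨‖L‖, norm_nonneg _, fun v => ?_⟩
  simpa [L, enorm_eq_norm] using L.le_opNorm (WithLp.toLp 2 v)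

lemma qnorm_nonneg {m n : ℕ} (P : G m n) : 0 ≤ qnorm P :=
  add_nonneg (enorm_nonneg _) (Real.sqrt_nonneg _)

lemma qnorm_eq_zero {m n : ℕ} {P : G m n} : qnorm P = 0 ↔ P = 0 := by
  rw [qnorm, add_eq_zero_iff_of_nonneg (enorm_nonneg _) (Real.sqrt_nonneg _),
    Real.sqrt_eq_zero (enorm_nonneg _), enorm_eq_zero, enorm_eq_zero, Prod.ext_iff]
  rfl

lemma continuous_qnorm {m n : ℕ} : Continuous (qnorm : G m n → ℝ) :=
  (continuous_enorm.comp continuous_fst).add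
    (continuous_enorm.comp continuous_snd).sqrt

lemma enorm_fst_le_qnorm {m n : ℕ} (P : G m n) : enorm P.1 ≤ qnorm P :=
  le_add_of_nonneg_right (Real.sqrt_nonneg _)

lemma continuous_gmul {m n : ℕ} (b : Fin n → Matrix (Fin m) (Fin m) ℝ) :
    Continuous fun p : G m n × G m n => gmul b p.1 p.2 := by
  unfold gmul
  fun_prop

lemma continuous_ginv {m n : ℕ} : Continuous (ginv : G m n → G m n) := by
  unfold ginv
  fun_prop

lemma continuous_embW {m n k : ℕ} : Continuous (embW m n k) := by
  unfold embW
  refine Continuous.prodMk (continuous_pi fun j => ?_) continuous_snd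
  split_ifs <;> fun_prop

lemma continuous_embH {m n k : ℕ} : Continuous (embH m n k) := by
  unfold embH
  refine Continuous.prodMk (continuous_pi fun j => ?_) continuous_const
  split_ifs <;> fun_prop

lemma continuous_sigma {m n k : ℕ} (b : Fin n → Matrix (Fin m) (Fin m) ℝ)
    {X : Type*} [TopologicalSpace X] {f : X → Fin k → ℝ} {u v : X → W m n k}
    (hf : Continuous f) (hu : Continuous u) (hv : Continuous v) :
    Continuous fun x => sigma m n k b (fun _ => f x) (u x) (v x) := by
  have hmul {P Q : X → G m n} (hP : Continuous P) (hQ : Continuous Q) :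
      Continuous fun x => gmul b (P x) (Q x) :=
    (continuous_gmul b).comp (hP.prodMk hQ)
  have hH : Continuous fun x => embH m n k (f x) := continuous_embH.comp hf
  have hA : Continuous fun x => embW m n k (u x) := continuous_embW.comp hu
  have hB : Continuous fun x => embW m n k (v x) := continuous_embW.comp hv
  exact continuous_qnorm.comp
    (hmul (hmul (hmul (continuous_ginv.comp hH) (continuous_ginv.comp hA)) hB) hH)

lemma sigma_nonneg {m n k : ℕ} (b : Fin n → Matrix (Fin m) (Fin m) ℝ)
    (φ : W m n k → Fin k → ℝ) (A B : W m n k) : 0 ≤ sigma m n k b φ A B :=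
  qnorm_nonneg _

lemma dW_eq_sigma {m n k : ℕ} (b : Fin n → Matrix (Fin m) (Fin m) ℝ) (A B : W m n k) :
    dW m n k b A B = sigma m n k b (fun _ => 0) A B := by
  have h0 : embH m n k 0 = 0 := by
    ext <;> simp [embH]
  simp [dW, sigma, gmul, ginv, h0]

lemma embW_fst_natAdd {m n k : ℕ} (A : W m n k) (i : Fin (m - k)) (h : k + (i : ℕ) < m) :
    (embW m n k A).1 ⟨k + i, h⟩ = A.1 i := by
  simp [embW]

lemma enorm_le_enorm_embW_sub {m n k : ℕ} (A B : W m n k) :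
    enorm (B.1 - A.1) ≤ enorm ((embW m n k B).1 - (embW m n k A).1) := by
  have hlt (i : Fin (m - k)) : k + (i : ℕ) < m := by have := i.isLt; omega
  let e : Fin (m - k) ↪ Fin m :=
    ⟨fun i => ⟨k + i, hlt i⟩, fun i j h => by simpa [Fin.ext_iff] using h⟩
  refine Real.sqrt_le_sqrt ?_
  calc ∑ i, ((B.1 - A.1) i) ^ 2
      = ∑ j ∈ Finset.univ.map e, (((embW m n k B).1 - (embW m n k A).1) j) ^ 2 := by
        rw [Finset.sum_map]
        refine Finset.sum_congr rfl fun i _ => ?_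
        have he (P : W m n k) : (embW m n k P).1 (e i) = P.1 i := embW_fst_natAdd P i (hlt i)
        simp only [Pi.sub_apply, he]
    _ ≤ _ := Finset.sum_le_sum_of_subset_of_nonneg (Finset.subset_univ _)
        fun _ _ _ => sq_nonneg _

lemma enorm_fst_sub_le_sigma {m n k : ℕ} (b : Fin n → Matrix (Fin m) (Fin m) ℝ)
    (φ : W m n k → Fin k → ℝ) (A B : W m n k) :
    enorm (B.1 - A.1) ≤ sigma m n k b φ A B := by
  refine (enorm_le_enorm_embW_sub A B).trans ((enorm_fst_le_qnorm _).trans' (le_of_eq ?_))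
  simp only [gmul, ginv]
  congr 1
  abel

lemma sum_skew_eq_zero {m : ℕ} {M : Matrix (Fin m) (Fin m) ℝ} (hM : M.transpose = -M)
    (x : Fin m → ℝ) : ∑ i, ∑ j, M i j * x j * x i = 0 := by
  have h : ∑ i, ∑ j, M i j * x j * x i = -∑ i, ∑ j, M i j * x j * x i := by
    conv_lhs => rw [Finset.sum_comm]
    simp only [← Finset.sum_neg_distrib]
    refine Finset.sum_congr rfl fun i _ => Finset.sum_congr rfl fun j _ => ?_
    have hij : M j i = -M i j := congrFun (congrFun hM i) j
    rw [hij]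
    ring
  linarith

lemma conj_snd {m n : ℕ} {b : Fin n → Matrix (Fin m) (Fin m) ℝ}
    (hskew : ∀ s, (b s).transpose = -(b s)) (P Q R : G m n) (hPQ : P.1 = Q.1)
    (hR : R.2 = 0) :
    gmul b (gmul b (gmul b (ginv R) (ginv P)) Q) R = (0, Q.2 - P.2) := by
  refine Prod.ext ?_ (funext fun s => ?_)
  · simp only [gmul, ginv, hPQ]
    abel
  · have h1 := sum_skew_eq_zero (hskew s) Q.1
    have h2 := sum_skew_eq_zero (hskew s) R.1
    simp only [gmul, ginv, hPQ, hR, Pi.add_apply, Pi.neg_apply, Pi.sub_apply, Pi.zero_apply,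
      mul_add, add_mul, mul_neg, neg_mul, neg_neg, neg_zero, Finset.sum_add_distrib,
      Finset.sum_neg_distrib, h1, h2]
    ring

lemma sigma_eq_zero_iff {m n k : ℕ} {b : Fin n → Matrix (Fin m) (Fin m) ℝ}
    (hskew : ∀ s, (b s).transpose = -(b s)) (φ : W m n k → Fin k → ℝ) (A B : W m n k) :
    sigma m n k b φ A B = 0 ↔ A = B := by
  have key (h : A.1 = B.1) :
      sigma m n k b φ A B = qnorm ((0, B.2 - A.2) : G m n) := by
    rw [sigma, conj_snd hskew _ _ _ (by simp [embW, h]) rfl]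
    rfl
  constructor
  · intro h
    have h1 : A.1 = B.1 := by
      have := le_antisymm (h ▸ enorm_fst_sub_le_sigma b φ A B) (enorm_nonneg _)
      exact (sub_eq_zero.1 (enorm_eq_zero.1 this)).symm
    rw [key h1, qnorm_eq_zero] at h
    exact Prod.ext h1 (sub_eq_zero.1 (congrArg Prod.snd h)).symm
  · rintro rfl
    rw [key rfl, qnorm_eq_zero, sub_self]
    rfl

lemma UID.exists_local_bound {m n k : ℕ} {b : Fin n → Matrix (Fin m) (Fin m) ℝ}
    (hskew : ∀ s, (b s).transpose = -(b s)) {O : Set (W m n k)} {φ : W m n k → Fin k → ℝ}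
    {A₀ : W m n k} {M : Matrix (Fin k) (Fin (m - k)) ℝ} (h : UID m n k b O φ A₀ M) :
    ∃ C : ℝ, 0 ≤ C ∧ ∃ r > 0, ∀ A ∈ O, ∀ B ∈ O, dW m n k b A₀ A < r → dW m n k b A B < r →
      enorm (φ B - φ A) ≤ C * sigma m n k b φ A B := by
  obtain ⟨C, hC, hM⟩ := exists_enorm_mulVec_le M
  obtain ⟨r, hr, H⟩ := h 1 one_pos
  refine ⟨1 + C, by positivity, r, hr, fun A hA B hB h1 h2 => ?_⟩
  rcases eq_or_ne A B with rfl | hne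
  · rw [sub_self, enorm_zero]
    exact mul_nonneg (by positivity) (sigma_nonneg ..)
  have hpos : 0 < dW m n k b A B := by
    rw [dW_eq_sigma]
    exact (sigma_nonneg ..).lt_of_ne fun h0 => hne ((sigma_eq_zero_iff hskew _ _ _).1 h0.symm)
  have hsplit : φ B - φ A = (fun j => φ B j - φ A j - ∑ i, M j i * (B.1 i - A.1 i)) +
      M.mulVec (B.1 - A.1) := by
    ext j
    simp [Matrix.mulVec, dotProduct]
  calc enorm (φ B - φ A)
      ≤ 1 * sigma m n k b φ A B + C * sigma m n k b φ A B := by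
        rw [hsplit]
        exact (enorm_add_le _ _).trans (add_le_add (H A hA B hB h1 h2 hpos)
          ((hM _).trans (mul_le_mul_of_nonneg_left (enorm_fst_sub_le_sigma ..) hC)))
    _ = (1 + C) * sigma m n k b φ A B := by ring

lemma continuous_dW {m n k : ℕ} (b : Fin n → Matrix (Fin m) (Fin m) ℝ)
    {X : Type*} [TopologicalSpace X] {u v : X → W m n k}
    (hu : Continuous u) (hv : Continuous v) : Continuous fun x => dW m n k b (u x) (v x) := by
  simp only [dW_eq_sigma]
  exact continuous_sigma b continuous_const hu hv

lemma dW_self {m n k : ℕ} {b : Fin n → Matrix (Fin m) (Fin m) ℝ}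
    (hskew : ∀ s, (b s).transpose = -(b s)) (A : W m n k) : dW m n k b A A = 0 := by
  rw [dW_eq_sigma, sigma_eq_zero_iff hskew]

lemma UID.continuousAt {m n k : ℕ} {b : Fin n → Matrix (Fin m) (Fin m) ℝ}
    (hskew : ∀ s, (b s).transpose = -(b s)) {O : Set (W m n k)} (hO : IsOpen O)
    {φ : W m n k → Fin k → ℝ} {A₀ : W m n k} (hA₀ : A₀ ∈ O)
    {M : Matrix (Fin k) (Fin (m - k)) ℝ} (h : UID m n k b O φ A₀ M) :
    ContinuousAt φ A₀ := by
  obtain ⟨C, -, r, hr, H⟩ := h.exists_local_bound hskew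
  have hd : ∀ᶠ B in 𝓝 A₀, dW m n k b A₀ B < r :=
    (continuous_dW b continuous_const continuous_id).continuousAt.eventually_lt
      continuousAt_const (by simpa [dW_self hskew] using hr)
  have hσ : Tendsto (fun B => C * sigma m n k b φ A₀ B) (𝓝 A₀) (𝓝 0) := by
    have hc : Continuous fun B => C * sigma m n k b φ A₀ B :=
      continuous_const.mul
        (continuous_sigma b (f := fun _ => φ A₀) continuous_const continuous_const continuous_id)
    simpa [(sigma_eq_zero_iff hskew φ A₀ A₀).2 rfl] using hc.tendsto A₀
  refine continuousAt_pi.2 fun j => tendsto_iff_norm_sub_tendsto_zero.2 ?_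
  refine squeeze_zero' (Eventually.of_forall fun _ => norm_nonneg _) ?_ hσ
  filter_upwards [hd, hO.mem_nhds hA₀] with B hB hBO
  exact (abs_apply_le_enorm (φ B - φ A₀) j).trans
    (H A₀ hA₀ B hBO (by rwa [dW_self hskew]) hB)

lemma eventually_bound {m n k : ℕ} {b : Fin n → Matrix (Fin m) (Fin m) ℝ}
    (hskew : ∀ s, (b s).transpose = -(b s)) {O : Set (W m n k)} (hO : IsOpen O)
    {φ : W m n k → Fin k → ℝ} (huid : ∀ A₀ ∈ O, ∃ M, UID m n k b O φ A₀ M)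
    {A₀ B₀ : W m n k} (hA₀ : A₀ ∈ O) (hB₀ : B₀ ∈ O) :
    ∃ C : ℝ, 0 ≤ C ∧ ∀ᶠ p : W m n k × W m n k in 𝓝 (A₀, B₀),
      enorm (φ p.2 - φ p.1) ≤ C * sigma m n k b φ p.1 p.2 := by
  obtain ⟨M, hM⟩ := huid A₀ hA₀
  rcases eq_or_ne A₀ B₀ with rfl | hne
  · obtain ⟨C, hC, r, hr, H⟩ := hM.exists_local_bound hskew
    have h0 : dW m n k b A₀ A₀ < r := by rwa [dW_self hskew]
    have hdW := continuous_dW b (continuous_fst (X := W m n k) (Y := W m n k)) continuous_snd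
    have hfst : Continuous fun p : W m n k × W m n k => dW m n k b A₀ p.1 :=
      continuous_dW b continuous_const continuous_fst
    refine ⟨C, hC, ?_⟩
    filter_upwards [(hO.prod hO).mem_nhds (Set.mk_mem_prod hA₀ hA₀),
      hfst.continuousAt.eventually_lt continuousAt_const h0,
      hdW.continuousAt.eventually_lt continuousAt_const h0]
      with p hp h1 h2
    exact H p.1 hp.1 p.2 hp.2 h1 h2
  · obtain ⟨M', hM'⟩ := huid B₀ hB₀
    have hφA : ContinuousAt (fun p : W m n k × W m n k => φ p.1) (A₀, B₀) :=
      ContinuousAt.comp (f := Prod.fst) (hM.continuousAt hskew hO hA₀) continuousAt_fst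
    have hφB : ContinuousAt (fun p : W m n k × W m n k => φ p.2) (A₀, B₀) :=
      ContinuousAt.comp (f := Prod.snd) (hM'.continuousAt hskew hO hB₀) continuousAt_snd
    have hσ : ContinuousAt (fun p : W m n k × W m n k => sigma m n k b φ p.1 p.2) (A₀, B₀) :=
      ContinuousAt.comp (f := fun p : W m n k × W m n k => (φ p.1, p))
        (continuous_sigma b continuous_fst (continuous_fst.comp continuous_snd)
          (continuous_snd.comp continuous_snd)).continuousAt (hφA.prodMk continuousAt_id)
    have hpos : 0 < sigma m n k b φ A₀ B₀ :=
      (sigma_nonneg ..).lt_of_ne fun h0 => hne ((sigma_eq_zero_iff hskew _ _ _).1 h0.symm)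
    have hq : ContinuousAt (fun p : W m n k × W m n k =>
        enorm (φ p.2 - φ p.1) / sigma m n k b φ p.1 p.2) (A₀, B₀) :=
      (continuous_enorm.continuousAt.comp (hφB.sub hφA)).div hσ hpos.ne'
    refine ⟨enorm (φ B₀ - φ A₀) / sigma m n k b φ A₀ B₀ + 1,
      add_nonneg (div_nonneg (enorm_nonneg _) hpos.le) zero_le_one, ?_⟩
    filter_upwards [hq.eventually_lt continuousAt_const (lt_add_one _),
      continuousAt_const.eventually_lt hσ hpos] with p h1 h2
    exact (div_le_iff₀ h2).1 h1.le

/-- A map `φ : 𝒪 → ℝ^k` which is uniformly intrinsically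
differentiable at every point of the open set `𝒪` is intrinsic Lipschitz on every
compact subset of `𝒪`. -/
theorem statement1 (m n k : ℕ) (hm : 2 ≤ m) (hn : 1 ≤ n) (hk : 1 ≤ k) (hkm : k < m)
    (b : Fin n → Matrix (Fin m) (Fin m) ℝ)
    (hskew : ∀ s, (b s).transpose = -(b s)) (hind : LinearIndependent ℝ b)
    (hblock : ∀ s (i j : Fin m), (i : ℕ) < k → (j : ℕ) < k → b s i j = 0)
    (O : Set (W m n k)) (hO : IsOpen O) (φ : W m n k → Fin k → ℝ)
    (huid : ∀ A₀ ∈ O, ∃ M, UID m n k b O φ A₀ M) :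
    ∀ K ⊆ O, IsCompact K →
      ∃ C : ℝ, 0 ≤ C ∧ ∀ A ∈ K, ∀ B ∈ K,
        enorm (fun j => φ B j - φ A j) ≤ C * sigma m n k b φ A B := by
  intro K hKO hK
  suffices h : ∃ C : ℝ, 0 ≤ C ∧ ∀ p ∈ K ×ˢ K,
      enorm (φ p.2 - φ p.1) ≤ C * sigma m n k b φ p.1 p.2 by
    obtain ⟨C, hC, H⟩ := h
    exact ⟨C, hC, fun A hA B hB => H (A, B) ⟨hA, hB⟩⟩
  refine (hK.prod hK).induction_on (p := fun s => ∃ C : ℝ, 0 ≤ C ∧ ∀ p ∈ s,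
    enorm (φ p.2 - φ p.1) ≤ C * sigma m n k b φ p.1 p.2) ⟨0, le_rfl, by simp⟩ ?_ ?_ ?_
  · rintro s t hst ⟨C, hC, H⟩
    exact ⟨C, hC, fun p hp => H p (hst hp)⟩
  · rintro s t ⟨C, hC, H⟩ ⟨D, -, H'⟩
    refine ⟨max C D, le_max_of_le_left hC, ?_⟩
    rintro p (hp | hp)
    · exact (H p hp).trans (mul_le_mul_of_nonneg_right (le_max_left _ _) (sigma_nonneg ..))
    · exact (H' p hp).trans (mul_le_mul_of_nonneg_right (le_max_right _ _) (sigma_nonneg ..))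
  · rintro ⟨A₀, B₀⟩ ⟨hA, hB⟩
    obtain ⟨C, hC, H⟩ := eventually_bound hskew hO huid (hKO hA) (hKO hB)
    exact ⟨_, mem_nhdsWithin_of_mem_nhds H, C, hC, fun p hp => hp⟩

end Carnot
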